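/- Let f = G·(T_1 + T_2), where G, T_1, T_2 ∈ F[x_1,…,x_n] are products of linear forms, T_1 and T_2 are homogeneous of equal positive degree, and T_1 and T_2 have no common linear factor (gcd(T_1,T_2) = 1). Then NonLin(f) (suitably scaled) lies in the F-subalgebra of F[x_1,…,x_n] generated by the linear factors of T_1·T_2; equivalently, NonLin(f) = h(y_1,…,y_r) for some polynomial h over F, where y_1,…,y_r is a basis of the F-subspace spanned by the linear factors of T_1·T_2. -/

import Mathlib

open MvPolynomial

/-- A linear form: a nonzero homogeneous degree-1 polynomial. -/
def IsLinearForm {F : Type*} [Field F] {n : ℕ} (ℓ : MvPolynomial (Fin n) F) : Prop :=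
  ℓ ≠ 0 ∧ ℓ.IsHomogeneous 1

/-- A product of linear forms (a nonzero scalar multiple of a product of linear forms). -/
def IsProdLinearForms {F : Type*} [Field F] {n : ℕ} (g : MvPolynomial (Fin n) F) : Prop :=
  ∃ (c : F) (L : Multiset (MvPolynomial (Fin n) F)),
    c ≠ 0 ∧ (∀ p ∈ L, IsLinearForm p) ∧ g = c • L.prod

/-- `g` has no linear factors. -/
def NoLinearFactor {F : Type*} [Field F] {n : ℕ} (g : MvPolynomial (Fin n) F) : Prop :=
  ∀ ℓ : MvPolynomial (Fin n) F, IsLinearForm ℓ → ¬ ℓ ∣ g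

/-- `h` is the non-linear part `NonLin(f)` of `f` (up to scalars): `h` has no linear
factors and `f` is a product of linear forms times `h`. -/
def IsNonLinPart {F : Type*} [Field F] {n : ℕ} (f h : MvPolynomial (Fin n) F) : Prop :=
  NoLinearFactor h ∧ ∃ L : MvPolynomial (Fin n) F, IsProdLinearForms L ∧ f = L * h

/-- `S(g)`: the set of codimension-2 subspaces `V(ℓ₁,ℓ₂)` of `F^n` on which `g`
vanishes, i.e. `g` belongs to the ideal generated by `ℓ₁, ℓ₂`. -/
def vanishCodim2 {F : Type*} [Field F] {n : ℕ} (g : MvPolynomial (Fin n) F) :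
    Set (Set (Fin n → F)) :=
  {W | ∃ ℓ₁ ℓ₂ : MvPolynomial (Fin n) F, IsLinearForm ℓ₁ ∧ IsLinearForm ℓ₂ ∧
    LinearIndependent F ![ℓ₁, ℓ₂] ∧
    W = {a : Fin n → F | eval a ℓ₁ = 0 ∧ eval a ℓ₂ = 0} ∧
    g ∈ Ideal.span {ℓ₁, ℓ₂}}

theorem IsLinearForm.prime {F : Type*} [Field F] {n : ℕ} {ℓ : MvPolynomial (Fin n) F}
    (hℓ : IsLinearForm ℓ) : Prime ℓ := by
  refine Irreducible.prime (irreducible_of_totalDegree_eq_one (hℓ.2.totalDegree hℓ.1) ?_)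
  intro x hx
  refine isUnit_iff_ne_zero.2 fun h0 => hℓ.1 ?_
  ext i
  simpa [h0] using hx i

/-- A polynomial without linear factors that divides a multiple of `g` by a product of linear
forms divides `g`. -/
theorem NoLinearFactor.dvd_of_dvd_mul_left {F : Type*} [Field F] {n : ℕ}
    {h G g : MvPolynomial (Fin n) F} (hh : NoLinearFactor h) (hG : IsProdLinearForms G)
    (hdvd : h ∣ G * g) : h ∣ g := by
  obtain ⟨c, L, hc, hL, rfl⟩ := hG
  rw [smul_mul_assoc, smul_eq_C_mul,
    ((isUnit_iff_ne_zero.2 hc).map C).dvd_mul_left] at hdvd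
  induction L using Multiset.induction_on with
  | empty => simpa using hdvd
  | cons p L ih =>
    refine ih (fun q hq => hL q (Multiset.mem_cons_of_mem hq)) ?_
    have hp := hL p (Multiset.mem_cons_self p L)
    rw [Multiset.prod_cons, mul_assoc] at hdvd
    obtain ⟨k, hk⟩ := hdvd
    obtain ⟨k', rfl⟩ := (hp.prime.dvd_or_dvd (Dvd.intro _ hk)).resolve_left (hh p hp)
    exact ⟨k', mul_left_cancel₀ hp.1 (by rw [hk]; ring)⟩

/-- The subalgebra generated by a set of linear forms is factorially closed. -/
theorem mem_adjoin_of_dvd {F : Type*} [Field F] {n : ℕ} {S : Set (MvPolynomial (Fin n) F)}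
    (hS : ∀ ℓ ∈ S, ℓ.IsHomogeneous 1) {a g : MvPolynomial (Fin n) F} (hg0 : g ≠ 0)
    (hg : g ∈ Algebra.adjoin F S) (hag : a ∣ g) : a ∈ Algebra.adjoin F S := by
  obtain ⟨π, hπ⟩ := (Submodule.span F S).subtype.exists_leftInverse_of_injective
    (Submodule.ker_subtype _)
  -- The line through the projection `π` (at `T = 0`) and the identity (at `T = 1`).
  let σ : MvPolynomial (Fin n) F →ₐ[F] Polynomial (MvPolynomial (Fin n) F) :=
    aeval fun i => Polynomial.C (π (X i) : MvPolynomial (Fin n) F) +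
      Polynomial.X * Polynomial.C (X i - (π (X i) : MvPolynomial (Fin n) F))
  have hσS : ∀ ℓ ∈ S, σ ℓ = Polynomial.C ℓ := by
    intro ℓ hℓ
    have hlin : ∀ q ∈ Submodule.span F (Set.range (X : Fin n → MvPolynomial (Fin n) F)),
        σ q = Polynomial.C (π q : MvPolynomial (Fin n) F) +
          Polynomial.X * Polynomial.C (q - (π q : MvPolynomial (Fin n) F)) := by
      intro q hq
      induction hq using Submodule.span_induction with
      | mem x hx =>
        obtain ⟨i, rfl⟩ := hx
        simp [σ]
      | zero => simp
      | add x y _ _ hx hy =>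
        simp only [map_add, hx, hy, Submodule.coe_add, map_sub]
        ring
      | smul c x _ hx =>
        simp only [map_smul, hx, Submodule.coe_smul, ← smul_sub, ← Polynomial.smul_C, smul_add,
          mul_smul_comm]
    have hπℓ : (π ℓ : MvPolynomial (Fin n) F) = ℓ :=
      congrArg Subtype.val (LinearMap.congr_fun hπ ⟨ℓ, Submodule.subset_span hℓ⟩)
    rw [hlin ℓ (by rw [← homogeneousSubmodule_one_eq_span_X]; exact hS ℓ hℓ), hπℓ]
    simp
  have hσ : ∀ p ∈ Algebra.adjoin F S, σ p = Polynomial.C p := by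
    intro p hp
    exact AlgHom.adjoin_le_equalizer σ
      (Polynomial.CAlgHom (R := F) (A := MvPolynomial (Fin n) F)) hσS hp
  have hone : ∀ p, (σ p).eval 1 = p := by
    intro p
    induction p using MvPolynomial.induction_on with
    | C c => simp [σ, Polynomial.algebraMap_apply, algebraMap_eq]
    | add p q hp hq => simp [hp, hq]
    | mul_X p i hp => rw [map_mul, Polynomial.eval_mul, hp]; simp [σ]
  have hzero : ∀ p, (σ p).eval 0 ∈ Algebra.adjoin F S := by
    intro p
    induction p using MvPolynomial.induction_on with
    | C c =>
      have : (σ (C c)).eval 0 = algebraMap F _ c := by simp [σ, Polynomial.algebraMap_apply]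
      rw [this]
      exact Subalgebra.algebraMap_mem _ c
    | add p q hp hq =>
      rw [map_add, Polynomial.eval_add]
      exact add_mem hp hq
    | mul_X p i hp =>
      rw [map_mul, Polynomial.eval_mul]
      refine mul_mem hp ?_
      have : (σ (X i)).eval 0 = (π (X i) : MvPolynomial (Fin n) F) := by simp [σ]
      rw [this]
      exact Algebra.span_le_adjoin F S (π (X i)).2
  have hdeg : (σ a).natDegree = 0 := by
    have hd : σ a ∣ Polynomial.C g := hσ g hg ▸ map_dvd σ hag
    have := Polynomial.natDegree_le_of_dvd hd (Polynomial.C_ne_zero.2 hg0)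
    simpa using this
  have h0 := hzero a
  have h1 := hone a
  rw [Polynomial.eq_C_of_natDegree_eq_zero hdeg, Polynomial.eval_C] at h0 h1
  exact h1 ▸ h0

theorem IsProdLinearForms.mem_adjoin {F : Type*} [Field F] {n : ℕ}
    {T P : MvPolynomial (Fin n) F} (hT : IsProdLinearForms T) (hTP : T ∣ P) :
    T ∈ Algebra.adjoin F {ℓ : MvPolynomial (Fin n) F | IsLinearForm ℓ ∧ ℓ ∣ P} := by
  obtain ⟨c, L, hc, hL, rfl⟩ := hT
  refine Subalgebra.smul_mem _ (Subalgebra.multiset_prod_mem _ fun p hp => ?_) c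
  exact Algebra.subset_adjoin
    ⟨hL p hp, ((Multiset.dvd_prod hp).trans
      (Dvd.intro_left (C c) (smul_eq_C_mul _ _).symm)).trans hTP⟩

theorem IsProdLinearForms.exists_dvd {F : Type*} [Field F] {n m : ℕ}
    {T : MvPolynomial (Fin n) F} (hT : IsProdLinearForms T) (hm : 0 < m)
    (hom : T.IsHomogeneous m) : ∃ ℓ, IsLinearForm ℓ ∧ ℓ ∣ T := by
  obtain ⟨c, L, hc, hL, rfl⟩ := hT
  rcases L.empty_or_exists_mem with rfl | ⟨p, hp⟩
  · rw [Multiset.prod_zero, smul_eq_C_mul, mul_one] at hom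
    exact absurd (hom.inj_right (isHomogeneous_C _ c) (C_ne_zero.2 hc)) hm.ne'
  · exact ⟨p, hL p hp, (Multiset.dvd_prod hp).trans
      (Dvd.intro_left (C c) (smul_eq_C_mul _ _).symm)⟩

/-- `NonLin(f)` lies in the `F`-subalgebra generated by the linear factors of `T₁·T₂`;
i.e. it is a polynomial in the linear forms dividing `T₁·T₂`. -/
theorem nonlin_mem_adjoin_gate_factors
    {F : Type*} [Field F] [Fintype F] {n m : ℕ}
    (G T₁ T₂ f h : MvPolynomial (Fin n) F)
    (hm : 0 < m)
    (hG : IsProdLinearForms G) (hT₁ : IsProdLinearForms T₁) (hT₂ : IsProdLinearForms T₂)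
    (hT₁hom : T₁.IsHomogeneous m) (hT₂hom : T₂.IsHomogeneous m)
    (hgcd : ∀ ℓ : MvPolynomial (Fin n) F, IsLinearForm ℓ → ℓ ∣ T₁ → ¬ ℓ ∣ T₂)
    (hf : f = G * (T₁ + T₂)) (hh : IsNonLinPart f h) :
    h ∈ Algebra.adjoin F {ℓ : MvPolynomial (Fin n) F | IsLinearForm ℓ ∧ ℓ ∣ T₁ * T₂} := by
  obtain ⟨hnl, L, -, hfL⟩ := hh
  have hdvd : h ∣ T₁ + T₂ :=
    hnl.dvd_of_dvd_mul_left hG (hf ▸ Dvd.intro_left L hfL.symm)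
  have hne : T₁ + T₂ ≠ 0 := by
    intro h0
    obtain ⟨ℓ, hℓ, hℓT⟩ := hT₁.exists_dvd hm hT₁hom
    exact hgcd ℓ hℓ hℓT ((dvd_add_right hℓT).1 (h0 ▸ dvd_zero ℓ))
  exact mem_adjoin_of_dvd (fun ℓ hℓ => hℓ.1.2) hne
    (add_mem (hT₁.mem_adjoin (dvd_mul_right _ _)) (hT₂.mem_adjoin (dvd_mul_left _ _))) hdvd
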